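/- (Second Andrews–Berkovich ₁₀φ₉ identity) Let n be a nonnegative integer and let q, a, u be nonzero complex numbers with a ≠ 1 (write k = u², so u is a square root of k) such that all factors appearing in denominators below are nonzero, i.e. (q;q)_n ≠ 0, (u²q;q²)_n ≠ 0, (qu;q)_n ≠ 0, (−u;q)_n ≠ 0, (a²q/u²;q)_n ≠ 0, (a q^{-n+1}/u²;q)_n ≠ 0, (a q^{n+1};q)_n ≠ 0, (u²;q)_n ≠ 0, and (u²/a;q)_n ≠ 0. Then ∑_{j=0}^{n} ( (a;q)_j · ((1 − a q^{2j})/(1 − a)) · (a²q/u²;q²)_j · (a/u;q)_j · (−aq/u;q)_j · (u²/a;q)_j · (u² q^n;q)_j · (q^{-n};q)_j / ( (q;q)_j (u²q;q²)_j (qu;q)_j (−u;q)_j (a²q/u²;q)_j (a q^{-n+1}/u²;q)_j (a q^{n+1};q)_j ) ) · q^j = (aq;q)_n (u;q)_n (u⁴/a²;q)_n / ((u²;q)_n (u²/a;q)_n (qu;q)_n). -/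

import Mathlib

/-- The $q$-shifted factorial $(a;q)_m = \prod_{k=0}^{m-1}(1 - a q^k)$. -/
noncomputable def qPoch (q a : ℂ) (m : ℕ) : ℂ := ∏ k ∈ Finset.range m, (1 - a * q ^ k)

section

open Finset

lemma qPoch_zero (q x : ℂ) : qPoch q x 0 = 1 := by simp [qPoch]

lemma qPoch_succ (q x : ℂ) (n : ℕ) :
    qPoch q x (n + 1) = qPoch q x n * (1 - x * q ^ n) := by
  simp [qPoch, prod_range_succ]

lemma qPoch_succ_left (q x : ℂ) (n : ℕ) :
    qPoch q x (n + 1) = (1 - x) * qPoch q (x * q) n := by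
  simp only [qPoch, prod_range_succ', pow_zero, mul_one]
  rw [mul_comm]
  congr 1
  exact prod_congr rfl fun k _ => by ring

lemma qPoch_add (q x : ℂ) (m n : ℕ) :
    qPoch q x (m + n) = qPoch q x m * qPoch q (x * q ^ m) n := by
  simp only [qPoch, prod_range_add]
  congr 1
  exact prod_congr rfl fun k _ => by ring

lemma qPoch_ne_zero_iff (q x : ℂ) (n : ℕ) :
    qPoch q x n ≠ 0 ↔ ∀ i < n, 1 - x * q ^ i ≠ 0 := by
  simp [qPoch, prod_ne_zero_iff]

lemma qPoch_ne_zero_of_le {q x : ℂ} {m n : ℕ} (h : qPoch q x n ≠ 0) (hmn : m ≤ n) :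
    qPoch q x m ≠ 0 :=
  (qPoch_ne_zero_iff q x m).2 fun i hi => (qPoch_ne_zero_iff q x n).1 h i (hi.trans_le hmn)

/-- Creative telescoping for sums over antidiagonals. -/
lemma sum_antidiagonal_recurrence {f g : ℕ → ℕ → ℂ} {c d : ℂ} {n : ℕ}
    (h : ∀ i j, i + j = n → c * f i (j + 1) - d * f i j = g (i + 1) j - g i (j + 1))
    (h0 : g 0 (n + 1) = 0) (h1 : c * f (n + 1) 0 = -g (n + 1) 0) :
    c * ∑ p ∈ antidiagonal (n + 1), f p.1 p.2 = d * ∑ p ∈ antidiagonal n, f p.1 p.2 := by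
  have e1 := Nat.sum_antidiagonal_succ (n := n) (f := fun p : ℕ × ℕ => g p.1 p.2)
  have e2 := Nat.sum_antidiagonal_succ' (n := n) (f := fun p : ℕ × ℕ => g p.1 p.2)
  have e3 : ∑ p ∈ antidiagonal n, (c * f p.1 (p.2 + 1) - d * f p.1 p.2) =
      ∑ p ∈ antidiagonal n, (g (p.1 + 1) p.2 - g p.1 (p.2 + 1)) :=
    sum_congr rfl fun p hp => h p.1 p.2 (mem_antidiagonal.1 hp)
  rw [sum_sub_distrib, sum_sub_distrib, ← mul_sum, ← mul_sum] at e3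
  rw [Nat.sum_antidiagonal_succ']
  simp only at e1 e2 ⊢
  linear_combination e3 + h1 - h0 - e1 + e2

/-- The q-Pfaff–Saalschütz sum, with the denominator parameter cleared. -/
lemma q_saalschutz {q : ℂ} (A B X : ℂ) (hq : q ≠ 0) (n : ℕ) (hn : qPoch q q n ≠ 0) :
    ∑ p ∈ antidiagonal n, qPoch q A p.1 * qPoch q B p.1 * qPoch q (A * B * X * q ^ p.1) p.2 *
        qPoch q X p.2 * X ^ p.1 / (qPoch q q p.1 * qPoch q q p.2) =
      qPoch q (X * A) n * qPoch q (X * B) n / qPoch q q n := by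
  induction n with
  | zero => simp [qPoch_zero]
  | succ n ih =>
    have hn' := qPoch_ne_zero_of_le hn n.le_succ
    have hc : 1 - q * q ^ n ≠ 0 := (qPoch_ne_zero_iff _ _ _).1 hn n n.lt_succ_self
    have key := sum_antidiagonal_recurrence (n := n) (c := 1 - q * q ^ n)
      (d := (1 - X * A * q ^ n) * (1 - X * B * q ^ n))
      (f := fun s t => qPoch q A s * qPoch q B s * qPoch q (A * B * X * q ^ s) t *
        qPoch q X t * X ^ s / (qPoch q q s * qPoch q q t))
      (g := fun s t => - q ^ t * (qPoch q A s * qPoch q B s * qPoch q (A * B * X / q * q ^ s) t *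
        qPoch q X t * X ^ s * (1 - q ^ s) / (qPoch q q s * qPoch q q t))) ?_ ?_ ?_
    · rw [ih hn'] at key
      refine mul_left_cancel₀ hc (key.trans ?_)
      simp only [qPoch_succ]
      have hc' : 1 - q ^ n * q ≠ 0 := by rwa [mul_comm]
      field_simp
    · intro s t hst
      have hs := qPoch_ne_zero_of_le hn (m := s) (by omega)
      have ht := qPoch_ne_zero_of_le hn (m := t) (by omega)
      have hs1 : 1 - q * q ^ s ≠ 0 := (qPoch_ne_zero_iff _ _ _).1 hn s (by omega)
      have ht1 : 1 - q * q ^ t ≠ 0 := (qPoch_ne_zero_iff _ _ _).1 hn t (by omega)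
      have e1 : A * B * X / q * q ^ (s + 1) = A * B * X * q ^ s := by
        field_simp
        ring
      have e2 : qPoch q (A * B * X / q * q ^ s) (t + 1) =
          (1 - A * B * X / q * q ^ s) * qPoch q (A * B * X * q ^ s) t := by
        rw [qPoch_succ_left]
        congr 2
        field_simp
      simp only [e1]
      simp only [e2, qPoch_succ, ← hst, pow_add, pow_one]
      generalize qPoch q (A * B * X * q ^ s) t = F1
      generalize qPoch q A s = F2
      generalize qPoch q B s = F3
      generalize qPoch q X t = F4
      generalize qPoch q q s = F5 at *
      generalize qPoch q q t = F6 at *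
      generalize q ^ s = x at *
      generalize q ^ t = y at *
      generalize X ^ s = z at *
      clear e1 e2
      have hs1' : 1 - x * q ≠ 0 := by rwa [mul_comm]
      field_simp
      ring
    · simp
    · simp [qPoch_zero]
      ring

lemma jackson_certificate {q u v x y : ℂ} (hu : u ≠ 0) (hv : v ≠ 0)
    (h1 : 1 - q * x ≠ 0) (h2 : 1 - q * y ≠ 0) (h3 : 1 - v ^ 2 * x ≠ 0)
    (h4 : 1 - u * v * (q * (x ^ 2 * y)) ≠ 0) (h5 : 1 - v * x ≠ 0) (h6 : 1 - u * x ≠ 0) :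
    (1 - u * (x * y * q)) * (1 - q * (x * y)) * (1 - v ^ 2 * (x * y * q)) *
        ((1 - u * v * x ^ 2) * (1 - v ^ 2 * (q * (x ^ 2 * y))) * (1 - q * v / u * y) /
          ((1 - v * x) * (1 - u * x) * (1 - v ^ 2 * x) * (1 - q * y) *
            (1 - u * v * (q * (x ^ 2 * y))))) -
      (1 - q * v ^ 2 / u * (x * y)) * (1 - q * (x * y)) * (1 - v ^ 2 * (x * y * q)) *
        ((1 - u * v * x ^ 2) / ((1 - v * x) * (1 - u * x) * (1 - v ^ 2 * x))) =
    -(y * (1 + v * (x * q) * y) *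
          ((1 - x * q) * (1 - u * v * x) * (1 - u / v * x) * (1 - v ^ 2 * (q * (x ^ 2 * y))) *
              (q * v / u) /
            ((1 - q * x) * (1 - v ^ 2 * x) * (1 - u * v * (q * (x ^ 2 * y)))))) +
      y * q * (1 + v * x * (y * q)) * ((1 - x) * (1 - q * v / u * y) / (1 - q * y)) := by
  rw [mul_comm x q]
  generalize hD1 : 1 - q * x = D1 at *
  generalize hD2 : 1 - q * y = D2 at *
  generalize hD3 : 1 - v ^ 2 * x = D3 at *
  generalize hD4 : 1 - u * v * (q * (x ^ 2 * y)) = D4 at *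
  generalize hD5 : 1 - v * x = D5 at *
  generalize hD6 : 1 - u * x = D6 at *
  field_simp
  subst hD1 hD2 hD3 hD4 hD5 hD6
  ring

/-- A specialised Jackson sum in Bailey-pair form. -/
lemma jackson_special {q u v : ℂ} (hu : u ≠ 0) (hv : v ≠ 0) (n : ℕ)
    (h1 : qPoch q q n ≠ 0) (h2 : qPoch q u (n + 1) ≠ 0) (h3 : qPoch q v (n + 1) ≠ 0)
    (h4 : qPoch q (v ^ 2) (n + 1) ≠ 0) (h5 : qPoch q (u * v) (2 * n + 1) ≠ 0) :
    ∑ p ∈ antidiagonal n, qPoch q (u * v) p.1 * (1 - u * v * (q ^ p.1) ^ 2) *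
        ((1 - v) * (1 - u)) * qPoch q (u / v) p.1 * qPoch q (v ^ 2) (2 * p.1 + p.2 + 1) *
        qPoch q (q * v / u) p.2 * (q * v / u) ^ p.1 /
        ((1 - v * q ^ p.1) * (1 - u * q ^ p.1) * qPoch q q p.1 * qPoch q (v ^ 2) (p.1 + 1) *
          qPoch q q p.2 * qPoch q (u * v) (2 * p.1 + p.2 + 1)) =
      qPoch q (q * v ^ 2 / u) n / qPoch q (q * u) n := by
  induction n with
  | zero =>
    have a1 := (qPoch_ne_zero_iff _ _ _).1 h2 0 (by omega)
    have a2 := (qPoch_ne_zero_iff _ _ _).1 h3 0 (by omega)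
    have a3 := (qPoch_ne_zero_iff _ _ _).1 h4 0 (by omega)
    have a4 := (qPoch_ne_zero_iff _ _ _).1 h5 0 (by omega)
    simp only [pow_zero, mul_one] at a1 a2 a3 a4
    simp [qPoch_zero, qPoch_succ]
    field_simp
  | succ n ih =>
    have ih' := ih (qPoch_ne_zero_of_le h1 (by omega)) (qPoch_ne_zero_of_le h2 (by omega))
      (qPoch_ne_zero_of_le h3 (by omega)) (qPoch_ne_zero_of_le h4 (by omega))
      (qPoch_ne_zero_of_le h5 (by omega))
    have b1 := (qPoch_ne_zero_iff _ _ _).1 h1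
    have b2 := (qPoch_ne_zero_iff _ _ _).1 h2
    have b3 := (qPoch_ne_zero_iff _ _ _).1 h3
    have b4 := (qPoch_ne_zero_iff _ _ _).1 h4
    have b5 := (qPoch_ne_zero_iff _ _ _).1 h5
    have c1 : 1 - q * q ^ n ≠ 0 := b1 n (by omega)
    have c2 : 1 - u * q ^ (n + 1) ≠ 0 := b2 (n + 1) (by omega)
    have c4 : 1 - v ^ 2 * q ^ (n + 1) ≠ 0 := b4 (n + 1) (by omega)
    have hu2 : qPoch q (q * u) (n + 1) ≠ 0 := by
      intro h
      apply h2
      rw [qPoch_succ_left, mul_comm u q, h, mul_zero]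
    have key := sum_antidiagonal_recurrence (n := n)
      (c := (1 - u * q ^ (n + 1)) * (1 - q * q ^ n) * (1 - v ^ 2 * q ^ (n + 1)))
      (d := (1 - q * v ^ 2 / u * q ^ n) * (1 - q * q ^ n) * (1 - v ^ 2 * q ^ (n + 1)))
      (f := fun j s => qPoch q (u * v) j * (1 - u * v * (q ^ j) ^ 2) *
        ((1 - v) * (1 - u)) * qPoch q (u / v) j * qPoch q (v ^ 2) (2 * j + s + 1) *
        qPoch q (q * v / u) s * (q * v / u) ^ j /
        ((1 - v * q ^ j) * (1 - u * q ^ j) * qPoch q q j * qPoch q (v ^ 2) (j + 1) *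
          qPoch q q s * qPoch q (u * v) (2 * j + s + 1)))
      (g := fun j s => -((1 - v) * (1 - u) * q ^ s * (1 + v * q ^ j * q ^ s) *
        ((1 - q ^ j) * qPoch q (u * v) j * qPoch q (u / v) j * qPoch q (v ^ 2) (2 * j + s) *
          qPoch q (q * v / u) s * (q * v / u) ^ j /
          (qPoch q q j * qPoch q (v ^ 2) j * qPoch q (u * v) (2 * j + s) * qPoch q q s))))
      ?_ ?_ ?_
    · rw [ih'] at key
      have hcc := mul_ne_zero (mul_ne_zero c2 c1) c4
      refine mul_left_cancel₀ hcc (key.trans ?_)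
      rw [qPoch_succ] at hu2
      have := left_ne_zero_of_mul hu2
      have hx := right_ne_zero_of_mul hu2
      rw [qPoch_succ, qPoch_succ]
      have : 1 - u * q ^ (n + 1) = 1 - q * u * q ^ n := by ring
      rw [this]
      field_simp
    · intro j s hjs
      have d1 := qPoch_ne_zero_of_le h1 (m := j) (by omega)
      have d2 := qPoch_ne_zero_of_le h1 (m := s) (by omega)
      have d3 := qPoch_ne_zero_of_le h4 (m := j) (by omega)
      have d4 := qPoch_ne_zero_of_le h5 (m := 2 * j + s) (by omega)
      have f1 := b1 j (by omega)
      have f2 := b1 s (by omega)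
      have f3 := b4 j (by omega)
      have f4 := b5 (2 * j + s) (by omega)
      have f5 := b5 (2 * j + s + 1) (by omega)
      have f6 := b3 j (by omega)
      have f7 := b2 j (by omega)
      have e1 : 2 * (j + 1) + s = 2 * j + s + 1 + 1 := by ring
      have e2 : 2 * j + (s + 1) = 2 * j + s + 1 := by ring
      have e3 : q ^ (2 * j + s) = (q ^ j) ^ 2 * q ^ s := by ring
      have e4 : q ^ (2 * j + s + 1) = q * ((q ^ j) ^ 2 * q ^ s) := by ring
      simp only [e1, e2, qPoch_succ, ← hjs, e3, e4] at *
      simp only [pow_add, pow_one] at *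
      generalize qPoch q (u * v) j = F1 at *
      generalize qPoch q (u / v) j = F2 at *
      generalize qPoch q (v ^ 2) (2 * j + s) = F3 at *
      generalize qPoch q (q * v / u) s = F4 at *
      generalize (q * v / u) ^ j = F5 at *
      generalize qPoch q q j = F6 at *
      generalize qPoch q (v ^ 2) j = F7 at *
      generalize qPoch q q s = F8 at *
      generalize qPoch q (u * v) (2 * j + s) = F9 at *
      clear ih ih' h1 h2 h3 h4 h5 b1 b2 b3 b4 b5 c1 c2 c4 hu2 e1 e2 e3 e4 hjs
      generalize q ^ j = x at *
      generalize q ^ s = y at *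
      have key := jackson_certificate hu hv f1 f2 f3 f5 f6 f7
      generalize (1 - u * (x * y * q)) * (1 - q * (x * y)) * (1 - v ^ 2 * (x * y * q)) = C1 at *
      generalize (1 - q * v ^ 2 / u * (x * y)) * (1 - q * (x * y)) *
        (1 - v ^ 2 * (x * y * q)) = C2 at *
      generalize 1 + v * (x * q) * y = C3 at *
      generalize 1 + v * x * (y * q) = C4 at *
      generalize 1 - u * v * x ^ 2 = D1 at *
      generalize 1 - u * v * (x ^ 2 * y) = D2 at *
      generalize 1 - v ^ 2 * (x ^ 2 * y) = D3 at *
      generalize 1 - u * v * (q * (x ^ 2 * y)) = D4 at *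
      generalize 1 - v ^ 2 * (q * (x ^ 2 * y)) = D5 at *
      generalize 1 - v ^ 2 * x = D6 at *
      generalize 1 - q * v / u * y = D7 at *
      generalize 1 - q * x = D8 at *
      generalize 1 - q * y = D9 at *
      generalize 1 - v * x = D10 at *
      generalize 1 - u * x = D11 at *
      generalize 1 - x * q = D12 at *
      generalize 1 - u * v * x = D13 at *
      generalize 1 - u / v * x = D14 at *
      generalize 1 - u = D15 at *
      generalize 1 - v = D16 at *
      generalize 1 - x = D17 at *
      rw [← sub_eq_zero] at key ⊢
      linear_combination D16 * D15 * F1 * F2 * F3 * F4 * F5 * D3 /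
        (F6 * F7 * F8 * (F9 * D2)) * key
    · simp
    · have d1 := qPoch_ne_zero_of_le h1 (m := n) (by omega)
      have d3 := qPoch_ne_zero_of_le h4 (m := n + 1) (by omega)
      have d4 := qPoch_ne_zero_of_le h5 (m := 2 * (n + 1)) (by omega)
      have f4 := b5 (2 * (n + 1)) (by omega)
      have f6 := b3 (n + 1) (by omega)
      have e3 : q ^ (2 * (n + 1)) = (q ^ (n + 1)) ^ 2 := by ring
      have e4 : qPoch q q (n + 1) = qPoch q q n * (1 - q ^ (n + 1)) := by
        rw [qPoch_succ, pow_succ' q n]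
      have c1' : 1 - q ^ (n + 1) ≠ 0 := by rwa [pow_succ']
      rw [e3] at f4
      simp only [add_zero, qPoch_zero, qPoch_succ _ _ (2 * (n + 1)), qPoch_succ _ _ (n + 1), e3,
        e4, pow_zero, ← pow_succ']
      generalize q ^ (n + 1) = x at *
      generalize qPoch q (v ^ 2) (n + 1) = F1 at *
      generalize qPoch q (u * v) (2 * (n + 1)) = F2 at *
      clear ih ih'
      generalize qPoch q (v ^ 2) (2 * (n + 1)) = F3 at *
      generalize qPoch q (u * v) (n + 1) = F4 at *
      generalize qPoch q (u / v) (n + 1) = F5 at *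
      generalize (q * v / u) ^ (n + 1) = F6 at *
      generalize qPoch q q n = F7 at *
      generalize hD1 : 1 - u * v * x ^ 2 = D1 at *
      generalize hD2 : 1 - u * x = D2 at *
      generalize hD3 : 1 - v * x = D3 at *
      generalize hD4 : 1 - v ^ 2 * x = D4 at *
      generalize hD5 : 1 - x = D5 at *
      field_simp
      subst hD1 hD2 hD3 hD4 hD5
      ring

lemma sum_antidiagonal_assoc (F : ℕ → ℕ → ℕ → ℂ) (n : ℕ) :
    ∑ p ∈ antidiagonal n, ∑ r ∈ antidiagonal p.2, F p.1 r.1 r.2 =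
      ∑ p ∈ antidiagonal n, ∑ r ∈ antidiagonal p.1, F r.1 r.2 p.2 := by
  simp only [sum_sigma']
  apply sum_nbij' (fun x => ⟨(x.1.1 + x.2.1, x.2.2), (x.1.1, x.2.1)⟩)
    (fun x => ⟨(x.2.1, x.2.2 + x.1.2), (x.2.2, x.1.2)⟩)
  · rintro ⟨⟨i, j⟩, ⟨k, l⟩⟩ h
    simp only [mem_sigma, HasAntidiagonal.mem_antidiagonal] at h ⊢
    exact ⟨by omega, by trivial⟩
  · rintro ⟨⟨i, j⟩, ⟨k, l⟩⟩ h
    simp only [mem_sigma, HasAntidiagonal.mem_antidiagonal] at h ⊢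
    exact ⟨by omega, by trivial⟩
  · rintro ⟨⟨i, j⟩, ⟨k, l⟩⟩ h
    simp only [mem_sigma, HasAntidiagonal.mem_antidiagonal] at h ⊢
    obtain ⟨h, rfl⟩ := h
    rfl
  · rintro ⟨⟨i, j⟩, ⟨k, l⟩⟩ h
    simp only [mem_sigma, HasAntidiagonal.mem_antidiagonal] at h ⊢
    obtain ⟨h, rfl⟩ := h
    rfl
  · intros
    rfl

/-- Andrews' change of parameter for well-poised Bailey pairs. -/
lemma bailey_transform {q u v : ℂ} (hq : q ≠ 0) (hu : u ≠ 0) (hv : v ≠ 0) (n : ℕ)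
    (h1 : qPoch q q n ≠ 0) (h2 : qPoch q (u * v) (2 * n + 1) ≠ 0) (w : ℕ → ℂ) :
    ∑ p ∈ antidiagonal n, w p.1 * (u / v) ^ p.1 * qPoch q (u / v) p.2 *
        qPoch q (u ^ 2 * q ^ (2 * p.1)) p.2 /
        (qPoch q q p.2 * qPoch q (u * v) (2 * p.1 + p.2 + 1)) =
      ∑ p ∈ antidiagonal n, qPoch q (u ^ 2 / (q * v ^ 2)) p.2 / qPoch q q p.2 *
        (u ^ 2 / (q * v ^ 2)) ^ p.1 *
        ∑ r ∈ antidiagonal p.1, w r.1 * (q * v / u) ^ r.1 * qPoch q (q * v / u) r.2 *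
          qPoch q (v ^ 2 * q ^ (2 * r.1 + 1)) r.2 /
          (qPoch q q r.2 * qPoch q (u * v) (2 * r.1 + r.2 + 1)) := by
  simp only [mul_sum]
  have key := sum_antidiagonal_assoc (fun j s t =>
    qPoch q (u ^ 2 / (q * v ^ 2)) t / qPoch q q t * (u ^ 2 / (q * v ^ 2)) ^ (j + s) *
      (w j * (q * v / u) ^ j * qPoch q (q * v / u) s *
          qPoch q (v ^ 2 * q ^ (2 * j + 1)) s /
          (qPoch q q s * qPoch q (u * v) (2 * j + s + 1)))) n
  have e : ∀ p ∈ antidiagonal n, ∀ r ∈ antidiagonal p.1, r.1 + r.2 = p.1 :=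
    fun p _ r hr => HasAntidiagonal.mem_antidiagonal.1 hr
  rw [sum_congr rfl fun p hp => sum_congr rfl fun r hr => by rw [← e p hp r hr], ← key]
  refine sum_congr rfl ?_
  rintro ⟨j, N⟩ hp
  have hjN : j + N = n := HasAntidiagonal.mem_antidiagonal.1 hp
  have hS := q_saalschutz (q * v / u) (v ^ 2 * q ^ (2 * j + 1)) (u ^ 2 / (q * v ^ 2)) hq N
    (qPoch_ne_zero_of_le h1 (by omega))
  have e1 : u ^ 2 / (q * v ^ 2) * (q * v / u) = u / v := by field_simp
  have e2 : u ^ 2 / (q * v ^ 2) * (v ^ 2 * q ^ (2 * j + 1)) = u ^ 2 * q ^ (2 * j) := by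
    field_simp
    ring
  have e3 : q * v / u * (v ^ 2 * q ^ (2 * j + 1)) * (u ^ 2 / (q * v ^ 2)) =
      u * v * q ^ (2 * j + 1) := by field_simp
  rw [e1, e2, e3] at hS
  have hN : qPoch q (u * v) (2 * j + N + 1) ≠ 0 := qPoch_ne_zero_of_le h2 (by omega)
  calc _ = w j * (u / v) ^ j / qPoch q (u * v) (2 * j + N + 1) *
        (qPoch q (u / v) N * qPoch q (u ^ 2 * q ^ (2 * j)) N / qPoch q q N) := by
        rw [mul_comm (qPoch q q N)]
        simp only [div_eq_mul_inv, mul_inv]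
        ring
    _ = _ := by
        rw [← hS, mul_sum]
        refine sum_congr rfl ?_
        rintro ⟨s, t⟩ hst
        have hst' : s + t = N := HasAntidiagonal.mem_antidiagonal.1 hst
        have g1 : qPoch q (u * v) (2 * j + N + 1) = qPoch q (u * v) (2 * j + s + 1) *
            qPoch q (u * v * q ^ (2 * j + 1) * q ^ s) t := by
          rw [← hst', show 2 * j + (s + t) + 1 = 2 * j + s + 1 + t by ring, qPoch_add]
          congr 2
          ring
        have g2 : (u / v) ^ j = (u ^ 2 / (q * v ^ 2)) ^ j * (q * v / u) ^ j := by
          rw [← mul_pow, e1]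
        rw [g1] at hN ⊢
        have hN1 := left_ne_zero_of_mul hN
        have hN2 := right_ne_zero_of_mul hN
        have k1 := qPoch_ne_zero_of_le h1 (m := s) (by omega)
        have k2 := qPoch_ne_zero_of_le h1 (m := t) (by omega)
        simp only [g2, pow_add (u ^ 2 / (q * v ^ 2))]
        generalize (u ^ 2 / (q * v ^ 2)) ^ j = z1
        generalize (u ^ 2 / (q * v ^ 2)) ^ s = z2
        generalize (q * v / u) ^ j = z3
        generalize qPoch q (u * v * q ^ (2 * j + 1) * q ^ s) t = z4 at *
        generalize qPoch q (u * v) (2 * j + s + 1) = z5 at *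
        generalize qPoch q (q * v / u) s = z6 at *
        generalize qPoch q (u ^ 2 / (q * v ^ 2)) t = z7 at *
        generalize qPoch q (v ^ 2 * q ^ (2 * j + 1)) s = z8 at *
        field_simp

lemma bailey_sum {q u v : ℂ} (hq : q ≠ 0) (hu : u ≠ 0) (hv : v ≠ 0) (n : ℕ)
    (h1 : qPoch q q n ≠ 0) (h2 : qPoch q u (n + 1) ≠ 0) (h3 : qPoch q v (n + 1) ≠ 0)
    (h4 : qPoch q (v ^ 2) (n + 1) ≠ 0) (h5 : qPoch q (u * v) (2 * n + 1) ≠ 0) :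
    ∑ p ∈ antidiagonal n, qPoch q (u * v) p.1 * (1 - u * v * (q ^ p.1) ^ 2) *
        ((1 - v) * (1 - u)) * qPoch q (u / v) p.1 * qPoch q (v ^ 2) (2 * p.1 + 1) /
        ((1 - v * q ^ p.1) * (1 - u * q ^ p.1) * qPoch q q p.1 * qPoch q (v ^ 2) (p.1 + 1)) *
        (u / v) ^ p.1 * qPoch q (u / v) p.2 * qPoch q (u ^ 2 * q ^ (2 * p.1)) p.2 /
        (qPoch q q p.2 * qPoch q (u * v) (2 * p.1 + p.2 + 1)) =
      qPoch q u n * qPoch q (u ^ 2 / v ^ 2) n / (qPoch q q n * qPoch q (q * u) n) := by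
  have hqu : qPoch q (q * u) n ≠ 0 := by
    rw [qPoch_succ_left, mul_comm u q] at h2
    exact right_ne_zero_of_mul h2
  rw [bailey_transform hq hu hv n h1 h5 (fun j => qPoch q (u * v) j *
    (1 - u * v * (q ^ j) ^ 2) * ((1 - v) * (1 - u)) * qPoch q (u / v) j *
    qPoch q (v ^ 2) (2 * j + 1) /
    ((1 - v * q ^ j) * (1 - u * q ^ j) * qPoch q q j * qPoch q (v ^ 2) (j + 1)))]
  have hS := q_saalschutz q (q * v ^ 2 / u) (u ^ 2 / (q * v ^ 2)) hq n h1
  have e1 : u ^ 2 / (q * v ^ 2) * (q * v ^ 2 / u) = u := by field_simp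
  have e2 : u ^ 2 / (q * v ^ 2) * q = u ^ 2 / v ^ 2 := by field_simp
  have e3 : q * (q * v ^ 2 / u) * (u ^ 2 / (q * v ^ 2)) = q * u := by field_simp
  rw [e1, e2, e3] at hS
  rw [show qPoch q u n * qPoch q (u ^ 2 / v ^ 2) n / (qPoch q q n * qPoch q (q * u) n) =
    (qPoch q (u ^ 2 / v ^ 2) n * qPoch q u n / qPoch q q n) / qPoch q (q * u) n by field_simp,
    ← hS, sum_div]
  refine sum_congr rfl ?_
  rintro ⟨r, t⟩ hrt
  have hrt' : r + t = n := HasAntidiagonal.mem_antidiagonal.1 hrt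
  have hJ := jackson_special hu hv r (qPoch_ne_zero_of_le h1 (by omega))
    (qPoch_ne_zero_of_le h2 (by omega)) (qPoch_ne_zero_of_le h3 (by omega))
    (qPoch_ne_zero_of_le h4 (by omega)) (qPoch_ne_zero_of_le h5 (by omega))
  have hJ' : ∑ p ∈ antidiagonal r, qPoch q (u * v) p.1 * (1 - u * v * (q ^ p.1) ^ 2) *
        ((1 - v) * (1 - u)) * qPoch q (u / v) p.1 * qPoch q (v ^ 2) (2 * p.1 + 1) /
        ((1 - v * q ^ p.1) * (1 - u * q ^ p.1) * qPoch q q p.1 * qPoch q (v ^ 2) (p.1 + 1)) *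
        (q * v / u) ^ p.1 * qPoch q (q * v / u) p.2 * qPoch q (v ^ 2 * q ^ (2 * p.1 + 1)) p.2 /
        (qPoch q q p.2 * qPoch q (u * v) (2 * p.1 + p.2 + 1)) =
      qPoch q (q * v ^ 2 / u) r / qPoch q (q * u) r := by
    rw [← hJ]
    refine sum_congr rfl fun p _ => ?_
    rw [show 2 * p.1 + p.2 + 1 = 2 * p.1 + 1 + p.2 by ring, qPoch_add q (v ^ 2) (2 * p.1 + 1) p.2]
    simp only [div_eq_mul_inv, mul_inv]
    ring
  simp only at hJ' ⊢
  rw [hJ']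
  have g : qPoch q (q * u) n = qPoch q (q * u) r * qPoch q (q * u * q ^ r) t := by
    rw [← qPoch_add, hrt']
  rw [g] at hqu ⊢
  have := left_ne_zero_of_mul hqu
  have := right_ne_zero_of_mul hqu
  have k1 := qPoch_ne_zero_of_le h1 (m := r) (by omega)
  have k2 := qPoch_ne_zero_of_le h1 (m := t) (by omega)
  generalize qPoch q (q * u * q ^ r) t = z1 at *
  generalize (u ^ 2 / (q * v ^ 2)) ^ r = z2
  generalize qPoch q (u ^ 2 / (q * v ^ 2)) t = z3
  field_simp

lemma qPoch_two_mul (q x : ℂ) (j : ℕ) :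
    qPoch q x (2 * j) = qPoch (q ^ 2) x j * qPoch (q ^ 2) (x * q) j := by
  induction j with
  | zero => simp [qPoch_zero]
  | succ j ih =>
    rw [show 2 * (j + 1) = 2 * j + 1 + 1 by ring]
    simp only [qPoch_succ, ih]
    ring

lemma qPoch_sq (q z : ℂ) (j : ℕ) :
    qPoch (q ^ 2) (z ^ 2) j = qPoch q z j * qPoch q (-z) j := by
  simp only [qPoch, ← prod_mul_distrib]
  exact prod_congr rfl fun k _ => by ring

lemma qPoch_reflect {q x : ℂ} (hq : q ≠ 0) (hx : x ≠ 0) (N j : ℕ) :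
    qPoch q (q ^ (1 - ((j + N : ℕ) : ℤ)) / x) j * qPoch q x N * x ^ j *
      (∏ i ∈ range j, -q ^ (N + i)) = qPoch q x (j + N) := by
  induction j with
  | zero => simp [qPoch_zero]
  | succ j ih =>
    have e1 : q ^ (1 - ((j + 1 + N : ℕ) : ℤ)) / x = (q ^ (N + j))⁻¹ / x := by
      rw [← zpow_natCast q (N + j), ← zpow_neg]
      congr 2
      push_cast
      ring
    have e2 : q ^ (1 - ((j + N : ℕ) : ℤ)) / x = (q ^ (N + j))⁻¹ / x * q := by
      rw [← zpow_natCast q (N + j), ← zpow_neg, div_mul_eq_mul_div, ← zpow_add_one₀ hq]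
      congr 2
      push_cast
      ring
    rw [e2] at ih
    rw [show j + 1 + N = j + N + 1 by ring, qPoch_succ q x (j + N), ← ih,
      show j + N + 1 = j + 1 + N by ring, e1, qPoch_succ_left, prod_range_succ, add_comm j N]
    have := pow_ne_zero (N + j) hq
    generalize qPoch q ((q ^ (N + j))⁻¹ / x * q) j = F
    generalize q ^ (N + j) = y at *
    field_simp
    ring

set_option maxHeartbeats 1000000 in
lemma well_poised_term_eq_bailey_term {q u v : ℂ} (hq : q ≠ 0) (hu : u ≠ 0) (hv : v ≠ 0) (j N : ℕ)
    (h1 : qPoch q q (j + N) ≠ 0) (h2 : qPoch (q ^ 2) (u ^ 2 * q) j ≠ 0)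
    (h3 : qPoch q (q * u) j ≠ 0) (h4 : qPoch q (-u) j ≠ 0)
    (h6 : qPoch q (q ^ (1 - ((j + N : ℕ) : ℤ)) / (u / v)) j ≠ 0)
    (h8 : qPoch q (u ^ 2) (j + N) ≠ 0) (h9 : qPoch q (u / v) (j + N) ≠ 0)
    (g1 : qPoch q u (j + 1) ≠ 0) (g2 : qPoch q v (j + 1) ≠ 0)
    (g3 : qPoch q (v ^ 2) (j + 1) ≠ 0) (g4 : qPoch q (u * v) (2 * j + N + 1) ≠ 0) :
    qPoch q (u * v) j * (1 - u * v * (q ^ j) ^ 2) *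
        ((1 - v) * (1 - u)) * qPoch q (u / v) j * qPoch q (v ^ 2) (2 * j + 1) /
        ((1 - v * q ^ j) * (1 - u * q ^ j) * qPoch q q j * qPoch q (v ^ 2) (j + 1)) *
        (u / v) ^ j * qPoch q (u / v) N * qPoch q (u ^ 2 * q ^ (2 * j)) N /
        (qPoch q q N * qPoch q (u * v) (2 * j + N + 1)) =
      (1 - u * v) * qPoch q (u ^ 2) (j + N) * qPoch q (u / v) (j + N) /
        (qPoch q q (j + N) * qPoch q (u * v) (j + N + 1)) *
      (qPoch q (u * v) j * ((1 - u * v * q ^ (2 * j)) / (1 - u * v)) *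
        qPoch (q ^ 2) (v ^ 2 * q) j *
        qPoch q v j * qPoch q (-(v * q)) j * qPoch q (u / v) j *
        qPoch q (u ^ 2 * q ^ (j + N)) j * qPoch q (q ^ (-((j + N : ℕ) : ℤ))) j /
        (qPoch q q j * qPoch (q ^ 2) (u ^ 2 * q) j * qPoch q (q * u) j * qPoch q (-u) j *
          qPoch q (v ^ 2 * q) j * qPoch q (q ^ (1 - ((j + N : ℕ) : ℤ)) / (u / v)) j *
          qPoch q (u * v * q ^ (j + N + 1)) j) * q ^ j) := by
  have huv : 1 - u * v ≠ 0 := by simpa using (qPoch_ne_zero_iff _ _ _).1 g4 0 (by omega)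
  have g4' := qPoch_ne_zero_of_le g4 (m := j + N + 1) (by omega)
  have k1 := qPoch_ne_zero_of_le h1 (m := j) (by omega)
  have k2 := qPoch_ne_zero_of_le h1 (m := N) (by omega)
  have k3 := (qPoch_ne_zero_iff _ _ _).1 g1 j (by omega)
  have k4 := (qPoch_ne_zero_iff _ _ _).1 g2 j (by omega)
  have W : qPoch q (u * v * q ^ (j + N + 1)) j =
      qPoch q (u * v) (2 * j + N + 1) / qPoch q (u * v) (j + N + 1) := by
    rw [eq_div_iff g4', mul_comm, ← qPoch_add]
    congr 1
    ring
  have S : qPoch q (u ^ 2 * q ^ (j + N)) j = qPoch (q ^ 2) (u ^ 2 * q) j *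
      qPoch q u j * qPoch q (-u) j * qPoch q (u ^ 2 * q ^ (2 * j)) N /
        qPoch q (u ^ 2) (j + N) := by
    rw [eq_div_iff h8, mul_comm, ← qPoch_add, show j + N + j = 2 * j + N by ring,
      qPoch_add, qPoch_two_mul, qPoch_sq]
    ring
  have U : qPoch q u j = (1 - u) * qPoch q (q * u) j / (1 - u * q ^ j) := by
    rw [eq_div_iff k3, ← qPoch_succ, qPoch_succ_left, mul_comm u q]
  have V : qPoch q v j = (1 - v) * qPoch q (v * q) j / (1 - v * q ^ j) := by
    rw [eq_div_iff k4, ← qPoch_succ, qPoch_succ_left]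
  have V2 : qPoch q (v ^ 2) (2 * j + 1) =
      (1 - v ^ 2) * (qPoch (q ^ 2) (v ^ 2 * q) j * (qPoch q (v * q) j * qPoch q (-(v * q)) j)) := by
    rw [qPoch_succ_left, qPoch_two_mul, ← qPoch_sq]
    ring_nf
  have R : qPoch q (q ^ (-((j + N : ℕ) : ℤ))) j =
      qPoch q (q ^ (1 - ((j + N : ℕ) : ℤ)) / (u / v)) j * qPoch q (u / v) N *
        qPoch q q (j + N) * (u / v) ^ j / (qPoch q q N * qPoch q (u / v) (j + N) * q ^ j) := by
    have r1 := qPoch_reflect hq hq N j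
    have r2 := qPoch_reflect hq (div_ne_zero hu hv) N j
    have e : q ^ (1 - ((j + N : ℕ) : ℤ)) / q = q ^ (-((j + N : ℕ) : ℤ)) := by
      rw [div_eq_mul_inv, ← zpow_sub_one₀ hq]
      congr 1
      ring
    rw [e] at r1
    have hqj := pow_ne_zero j hq
    rw [eq_div_iff (mul_ne_zero (mul_ne_zero k2 h9) hqj), ← r1]
    nth_rewrite 1 [← r2]
    ring
  rw [qPoch_succ_left q (v ^ 2)] at g3
  rw [W, S, U, V, R, V2, qPoch_succ_left q (v ^ 2) j]
  have g31 := left_ne_zero_of_mul g3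
  have g32 := right_ne_zero_of_mul g3
  rw [pow_mul' q 2 j]
  have hqj := pow_ne_zero j hq
  clear W S U V V2 R
  generalize qPoch q (q ^ (1 - ((j + N : ℕ) : ℤ)) / (u / v)) j = z1 at *
  generalize qPoch q (u * v) (2 * j + N + 1) = z2 at *
  generalize qPoch q (u * v) (j + N + 1) = z3 at *
  generalize qPoch q (u ^ 2) (j + N) = z4 at *
  generalize qPoch q (u / v) (j + N) = z5 at *
  generalize qPoch q (u / v) j = z6 at *
  generalize qPoch q (u / v) N = z7 at *
  generalize qPoch q (v ^ 2 * q) j = z8 at *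
  generalize qPoch (q ^ 2) (v ^ 2 * q) j = z9 at *
  generalize qPoch (q ^ 2) (u ^ 2 * q) j = z10 at *
  generalize qPoch q (u ^ 2 * (q ^ j) ^ 2) N = z11 at *
  generalize qPoch q (q * u) j = z19 at *
  generalize qPoch q (u * v) j = z20 at *
  generalize qPoch q (-u) j = z21 at *
  generalize qPoch q q j = z22 at *
  generalize qPoch q q N = z23 at *
  generalize qPoch q q (j + N) = z24 at *
  generalize 1 - u * v * (q ^ j) ^ 2 = z25 at *
  generalize qPoch q (v * q) j = z12 at *
  generalize qPoch q (-(v * q)) j = z13 at *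
  generalize (u / v) ^ j = z14 at *
  generalize 1 - v ^ 2 = z15 at *
  generalize 1 - u * v = z16 at *
  generalize 1 - u * q ^ j = z17 at *
  generalize 1 - v * q ^ j = z18 at *
  generalize q ^ j = z26 at *
  clear hq hu hv g1 g2
  field_simp

lemma andrews_berkovich_generic {q u v : ℂ} (hq : q ≠ 0) (hu : u ≠ 0) (hv : v ≠ 0) (n : ℕ)
    (h1 : qPoch q q n ≠ 0) (h2 : qPoch (q ^ 2) (u ^ 2 * q) n ≠ 0)
    (h3 : qPoch q (q * u) n ≠ 0) (h4 : qPoch q (-u) n ≠ 0)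
    (h6 : qPoch q (q ^ (1 - (n : ℤ)) / (u / v)) n ≠ 0)
    (h8 : qPoch q (u ^ 2) n ≠ 0) (h9 : qPoch q (u / v) n ≠ 0)
    (g1 : qPoch q u (n + 1) ≠ 0) (g2 : qPoch q v (n + 1) ≠ 0)
    (g3 : qPoch q (v ^ 2) (n + 1) ≠ 0) (g4 : qPoch q (u * v) (2 * n + 1) ≠ 0) :
    ∑ j ∈ range (n + 1),
      qPoch q (u * v) j * ((1 - u * v * q ^ (2 * j)) / (1 - u * v)) *
        qPoch (q ^ 2) (v ^ 2 * q) j *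
        qPoch q v j * qPoch q (-(v * q)) j * qPoch q (u / v) j *
        qPoch q (u ^ 2 * q ^ n) j * qPoch q (q ^ (-(n : ℤ))) j /
        (qPoch q q j * qPoch (q ^ 2) (u ^ 2 * q) j * qPoch q (q * u) j * qPoch q (-u) j *
          qPoch q (v ^ 2 * q) j * qPoch q (q ^ (1 - (n : ℤ)) / (u / v)) j *
          qPoch q (u * v * q ^ (n + 1)) j) * q ^ j =
      qPoch q (u * v * q) n * qPoch q u n * qPoch q (u ^ 2 / v ^ 2) n /
        (qPoch q (u ^ 2) n * qPoch q (u / v) n * qPoch q (q * u) n) := by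
  have huv : 1 - u * v ≠ 0 := by simpa using (qPoch_ne_zero_iff _ _ _).1 g4 0 (by omega)
  have g4' := qPoch_ne_zero_of_le g4 (m := n + 1) (by omega)
  have hB := bailey_sum hq hu hv n h1 g1 g2 g3 g4
  rw [← Nat.sum_antidiagonal_eq_sum_range_succ_mk (fun p : ℕ × ℕ =>
    qPoch q (u * v) p.1 * ((1 - u * v * q ^ (2 * p.1)) / (1 - u * v)) *
        qPoch (q ^ 2) (v ^ 2 * q) p.1 *
        qPoch q v p.1 * qPoch q (-(v * q)) p.1 * qPoch q (u / v) p.1 *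
        qPoch q (u ^ 2 * q ^ n) p.1 * qPoch q (q ^ (-(n : ℤ))) p.1 /
        (qPoch q q p.1 * qPoch (q ^ 2) (u ^ 2 * q) p.1 * qPoch q (q * u) p.1 *
          qPoch q (-u) p.1 *
          qPoch q (v ^ 2 * q) p.1 * qPoch q (q ^ (1 - (n : ℤ)) / (u / v)) p.1 *
          qPoch q (u * v * q ^ (n + 1)) p.1) * q ^ p.1) n]
  have hK : (1 - u * v) * qPoch q (u ^ 2) n * qPoch q (u / v) n /
        (qPoch q q n * qPoch q (u * v) (n + 1)) ≠ 0 :=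
    div_ne_zero (mul_ne_zero (mul_ne_zero huv h8) h9) (mul_ne_zero h1 g4')
  refine mul_left_cancel₀ hK ?_
  rw [mul_sum]
  trans qPoch q u n * qPoch q (u ^ 2 / v ^ 2) n / (qPoch q q n * qPoch q (q * u) n)
  · rw [← hB]
    refine sum_congr rfl ?_
    rintro ⟨j, N⟩ hp
    obtain rfl : j + N = n := HasAntidiagonal.mem_antidiagonal.1 hp
    exact (well_poised_term_eq_bailey_term hq hu hv j N h1 (qPoch_ne_zero_of_le h2 (by omega))
      (qPoch_ne_zero_of_le h3 (by omega)) (qPoch_ne_zero_of_le h4 (by omega))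
      (qPoch_ne_zero_of_le h6 (by omega)) h8 h9 (qPoch_ne_zero_of_le g1 (by omega))
      (qPoch_ne_zero_of_le g2 (by omega)) (qPoch_ne_zero_of_le g3 (by omega))
      (qPoch_ne_zero_of_le g4 (by omega))).symm
  · rw [qPoch_succ_left] at g4' ⊢
    have := right_ne_zero_of_mul g4'
    generalize qPoch q (u * v * q) n = z1 at *
    generalize 1 - u * v = z2 at *
    generalize qPoch q (u / v) n = z3 at *
    generalize qPoch q (u ^ 2 / v ^ 2) n = z4 at *
    field_simp

lemma continuousAt_qPoch {f : ℂ → ℂ} {a : ℂ} (hf : ContinuousAt f a) (q : ℂ) (m : ℕ) :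
    ContinuousAt (fun b => qPoch q (f b) m) a := by
  unfold qPoch
  fun_prop

lemma eventually_qPoch_mul_ne_zero (q a c : ℂ) (m : ℕ) :
    ∀ᶠ b in nhdsWithin a {a}ᶜ, qPoch q (b * c) m ≠ 0 := by
  simp only [qPoch_ne_zero_iff, ← mem_range]
  refine (Filter.eventually_all_finset _).2 fun i _ => ?_
  filter_upwards [nhdsNE_le_cofinite a (Set.finite_singleton (c * q ^ i)⁻¹).compl_mem_cofinite]
    with b hb h
  refine hb (eq_inv_of_mul_eq_one_left ?_)
  linear_combination -h

end

/-- Second Andrews–Berkovich ${}_{10}\phi_9$ identity, with $k = u^2$. -/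
theorem andrews_berkovich_second (n : ℕ) (q a u : ℂ)
    (hq : q ≠ 0) (ha : a ≠ 0) (hu : u ≠ 0) (ha1 : a ≠ 1)
    (h1 : qPoch q q n ≠ 0) (h2 : qPoch (q ^ 2) (u ^ 2 * q) n ≠ 0)
    (h3 : qPoch q (q * u) n ≠ 0) (h4 : qPoch q (-u) n ≠ 0)
    (h5 : qPoch q (a ^ 2 * q / u ^ 2) n ≠ 0)
    (h6 : qPoch q (a * q ^ (1 - (n : ℤ)) / u ^ 2) n ≠ 0)
    (h7 : qPoch q (a * q ^ (n + 1)) n ≠ 0)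
    (h8 : qPoch q (u ^ 2) n ≠ 0) (h9 : qPoch q (u ^ 2 / a) n ≠ 0) :
    ∑ j ∈ Finset.range (n + 1),
      qPoch q a j * ((1 - a * q ^ (2 * j)) / (1 - a)) * qPoch (q ^ 2) (a ^ 2 * q / u ^ 2) j *
        qPoch q (a / u) j * qPoch q (-(a * q / u)) j * qPoch q (u ^ 2 / a) j *
        qPoch q (u ^ 2 * q ^ n) j * qPoch q (q ^ (-(n : ℤ))) j /
        (qPoch q q j * qPoch (q ^ 2) (u ^ 2 * q) j * qPoch q (q * u) j * qPoch q (-u) j *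
          qPoch q (a ^ 2 * q / u ^ 2) j * qPoch q (a * q ^ (1 - (n : ℤ)) / u ^ 2) j *
          qPoch q (a * q ^ (n + 1)) j) * q ^ j
    = qPoch q (a * q) n * qPoch q u n * qPoch q (u ^ 4 / a ^ 2) n /
        (qPoch q (u ^ 2) n * qPoch q (u ^ 2 / a) n * qPoch q (q * u) n) := by
  rcases Nat.eq_zero_or_pos n with rfl | hn
  · have : 1 - a ≠ 0 := sub_ne_zero.2 ha1.symm
    simp [qPoch_zero, this]
  have ha1' : 1 - a ≠ 0 := sub_ne_zero.2 ha1.symm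
  have hu1 : 1 - u ≠ 0 := by
    intro h
    apply (qPoch_ne_zero_iff _ _ _).1 h8 0 hn
    linear_combination (1 + u) * h
  have g1 : qPoch q u (n + 1) ≠ 0 := by
    rw [qPoch_succ_left, mul_comm u q]
    exact mul_ne_zero hu1 h3
  have c5 (j : ℕ) : ContinuousAt (fun b => qPoch q (b ^ 2 * q / u ^ 2) j) a :=
    continuousAt_qPoch (by fun_prop) _ _
  have c6 (j : ℕ) : ContinuousAt (fun b => qPoch q (b * q ^ (1 - (n : ℤ)) / u ^ 2) j) a :=
    continuousAt_qPoch (by fun_prop) _ _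
  have c7 (j : ℕ) : ContinuousAt (fun b => qPoch q (b * q ^ (n + 1)) j) a :=
    continuousAt_qPoch (by fun_prop) _ _
  have c9 (j : ℕ) : ContinuousAt (fun b => qPoch q (u ^ 2 / b) j) a :=
    continuousAt_qPoch (by fun_prop (disch := assumption)) _ _
  have c0 (x : ℂ) (j : ℕ) : ContinuousAt (fun b => qPoch q (b * x) j) a :=
    continuousAt_qPoch (by fun_prop) _ _
  have c1 (j : ℕ) : ContinuousAt (fun b => qPoch q b j) a :=
    continuousAt_qPoch (by fun_prop) _ _
  have c2 (j : ℕ) : ContinuousAt (fun b => qPoch (q ^ 2) (b ^ 2 * q / u ^ 2) j) a :=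
    continuousAt_qPoch (by fun_prop) _ _
  have c3 (j : ℕ) : ContinuousAt (fun b => qPoch q (b / u) j) a :=
    continuousAt_qPoch (by fun_prop) _ _
  have c4 (j : ℕ) : ContinuousAt (fun b => qPoch q (-(b * q / u)) j) a :=
    continuousAt_qPoch (by fun_prop) _ _
  have c8 : ContinuousAt (fun b => qPoch q (u ^ 4 / b ^ 2) n) a :=
    continuousAt_qPoch (by fun_prop (disch := simpa using ha)) _ _
  have hL : ContinuousAt (fun b => ∑ j ∈ Finset.range (n + 1),
      qPoch q b j * ((1 - b * q ^ (2 * j)) / (1 - b)) * qPoch (q ^ 2) (b ^ 2 * q / u ^ 2) j *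
        qPoch q (b / u) j * qPoch q (-(b * q / u)) j * qPoch q (u ^ 2 / b) j *
        qPoch q (u ^ 2 * q ^ n) j * qPoch q (q ^ (-(n : ℤ))) j /
        (qPoch q q j * qPoch (q ^ 2) (u ^ 2 * q) j * qPoch q (q * u) j * qPoch q (-u) j *
          qPoch q (b ^ 2 * q / u ^ 2) j * qPoch q (b * q ^ (1 - (n : ℤ)) / u ^ 2) j *
          qPoch q (b * q ^ (n + 1)) j) * q ^ j) a := by
    refine tendsto_finsetSum _ fun j hj => ?_
    have hj' : j ≤ n := by simpa [Nat.lt_succ_iff] using hj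
    have hD : qPoch q q j * qPoch (q ^ 2) (u ^ 2 * q) j * qPoch q (q * u) j * qPoch q (-u) j *
          qPoch q (a ^ 2 * q / u ^ 2) j * qPoch q (a * q ^ (1 - (n : ℤ)) / u ^ 2) j *
          qPoch q (a * q ^ (n + 1)) j ≠ 0 := by
      simp only [ne_eq, mul_eq_zero, not_or]
      exact ⟨⟨⟨⟨⟨⟨qPoch_ne_zero_of_le h1 hj', qPoch_ne_zero_of_le h2 hj'⟩,
        qPoch_ne_zero_of_le h3 hj'⟩, qPoch_ne_zero_of_le h4 hj'⟩,
        qPoch_ne_zero_of_le h5 hj'⟩, qPoch_ne_zero_of_le h6 hj'⟩, qPoch_ne_zero_of_le h7 hj'⟩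
    have c10 : ContinuousAt (fun b : ℂ => (1 - b * q ^ (2 * j)) / (1 - b)) a := by
      fun_prop (disch := assumption)
    have cN := ((((((((c1 j).mul c10).mul (c2 j)).mul (c3 j)).mul (c4 j)).mul (c9 j)).mul
      (continuousAt_const (y := qPoch q (u ^ 2 * q ^ n) j))).mul
      (continuousAt_const (y := qPoch q (q ^ (-(n : ℤ))) j)))
    have cD := (((continuousAt_const (y := qPoch q q j * qPoch (q ^ 2) (u ^ 2 * q) j *
      qPoch q (q * u) j * qPoch q (-u) j)).mul (c5 j)).mul (c6 j)).mul (c7 j)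
    exact (cN.div₀ cD hD).mul continuousAt_const
  have hR : ContinuousAt (fun b => qPoch q (b * q) n * qPoch q u n * qPoch q (u ^ 4 / b ^ 2) n /
        (qPoch q (u ^ 2) n * qPoch q (u ^ 2 / b) n * qPoch q (q * u) n)) a :=
    (((c0 q n).mul continuousAt_const).mul c8).div₀
      ((continuousAt_const.mul (c9 n)).mul continuousAt_const)
      (mul_ne_zero (mul_ne_zero h8 h9) h3)
  refine tendsto_nhds_unique_of_eventuallyEq (hL.mono_left (nhdsWithin_le_nhds (s := {a}ᶜ)))
    (hR.mono_left nhdsWithin_le_nhds) ?_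
  have near {P : ℂ → Prop} (h : ∀ᶠ b in nhds a, P b) : ∀ᶠ b in nhdsWithin a {a}ᶜ, P b :=
    h.filter_mono nhdsWithin_le_nhds
  have avoid (c : ℂ) : ∀ᶠ b in nhdsWithin a {a}ᶜ, b ≠ c :=
    nhdsNE_le_cofinite a (Set.finite_singleton c).compl_mem_cofinite
  filter_upwards [near ((c5 n).eventually_ne h5), near ((c6 n).eventually_ne h6),
    near ((c9 n).eventually_ne h9), avoid 0, avoid u, avoid (-u),
    eventually_qPoch_mul_ne_zero q a 1 (2 * n + 1),
    eventually_qPoch_mul_ne_zero q a u⁻¹ (n + 1)] with b e5 e6 e9 hb hbu hbu' g4 g2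
  have r1 : u * (b / u) = b := by field_simp
  have r2 : (b / u) ^ 2 * q = b ^ 2 * q / u ^ 2 := by field_simp
  have r3 : b / u * q = b * q / u := by field_simp
  have r4 : u / (b / u) = u ^ 2 / b := by field_simp
  have r5 : q ^ (1 - (n : ℤ)) / (u ^ 2 / b) = b * q ^ (1 - (n : ℤ)) / u ^ 2 := by
    generalize q ^ (1 - (n : ℤ)) = x
    field_simp
  have r6 : u ^ 2 / (b / u) ^ 2 = u ^ 4 / b ^ 2 := by field_simp
  have g3 : qPoch q ((b / u) ^ 2) (n + 1) ≠ 0 := by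
    rw [qPoch_succ_left, r2]
    refine mul_ne_zero (fun h => ?_) e5
    have h' : (b - u) * (b + u) = 0 := by
      field_simp at h
      linear_combination -h
    rcases mul_eq_zero.1 h' with h' | h'
    · exact hbu (sub_eq_zero.1 h')
    · exact hbu' (eq_neg_of_add_eq_zero_left h')
  have key := andrews_berkovich_generic (v := b / u) hq hu (div_ne_zero hb hu) n h1 h2 h3 h4
    (by rwa [r4, r5]) h8 (by rwa [r4]) g1 (by rwa [div_eq_mul_inv]) g3
    (by rwa [r1, ← mul_one b])
  simpa only [r1, r2, r3, r4, r5, r6] using key
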